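/- Let w ≥ 1 be an integer and let p be a homogeneous polynomial of degree w in X, Y with rational coefficients. If p(X,Y) = (−1)^w·p(X+Y,Y) and p(X,Y) = (−1)^w·p(X,X+Y), then p = 0. (Equivalently, no nonzero homogeneous polynomial of positive degree is annihilated by both 1−US and 1−U²S under the right action p|_γ(X,Y) = p(aX+bY,cX+dY), where S = (0 −1; 1 0) and U = (1 −1; 1 0).) -/

import Mathlib

open MvPolynomial

/-- Substitution: `sub2 a b p` is `p(a, b)` for a bivariate polynomial `p(X,Y)`. -/
noncomputable def sub2 (a b p : MvPolynomial (Fin 2) ℚ) : MvPolynomial (Fin 2) ℚ :=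
  aeval ![a, b] p

/-- `memV w ε p` : `p ∈ V_w^ε`, i.e. `p` is homogeneous of degree `w` and
`p(-X,Y) = ε p(X,Y)`. -/
def memV (w : ℕ) (ε : ℤ) (p : MvPolynomial (Fin 2) ℚ) : Prop :=
  p.IsHomogeneous w ∧ sub2 (-X 0) (X 1) p = (ε : ℚ) • p

/-- `memW w ε p` : `p ∈ W_w^ε`, the space of period polynomials: `p ∈ V_w^ε` with
`p(X,Y) + p(-Y,X) = 0` and `p(X,Y) + p(X-Y,X) + p(-Y,X-Y) = 0`. -/
def memW (w : ℕ) (ε : ℤ) (p : MvPolynomial (Fin 2) ℚ) : Prop :=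
  memV w ε p ∧
  p + sub2 (-X 1) (X 0) p = 0 ∧
  p + sub2 (X 0 - X 1) (X 0) p + sub2 (-X 1) (X 0 - X 1) p = 0

theorem MvPolynomial.IsHomogeneous.eval_smul_eq {R σ : Type*} [CommSemiring R]
    {p : MvPolynomial σ R} {w : ℕ} (hp : p.IsHomogeneous w) (c : R) (v : σ → R) :
    eval (c • v) p = c ^ w * eval v p := by
  rw [eval_eq, eval_eq, Finset.mul_sum]
  refine Finset.sum_congr rfl fun m hm => ?_
  have hdeg : ∑ i ∈ m.support, m i = w :=
    (hp.degree_eq_sum_deg_support hm).symm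
  simp only [Pi.smul_apply, smul_eq_mul, mul_pow, Finset.prod_mul_distrib,
    Finset.prod_pow_eq_pow_sum, hdeg]
  ring

theorem eval_add_smul_eq_of_forall_nat {K σ : Type*} [Field K] [CharZero K]
    (p : MvPolynomial σ K) (u d : σ → K)
    (h : ∀ n : ℕ, eval (u + (n : K) • d) p = eval u p) (t : K) :
    eval (u + t • d) p = eval u p := by
  let q : Polynomial K :=
    aeval (fun i => Polynomial.C (u i) + Polynomial.X * Polynomial.C (d i)) p
  have hq : ∀ s : K, q.eval s = eval (u + s • d) p := by
    intro s
    have hcomp : (Polynomial.aeval s).comp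
        (aeval (fun i => Polynomial.C (u i) + Polynomial.X * Polynomial.C (d i))) =
        (aeval (u + s • d) : MvPolynomial σ K →ₐ[K] K) := by
      ext i
      simpa using mul_comm (d i) s
    simpa [q, Polynomial.coe_aeval_eq_eval, aeval_eq_eval] using DFunLike.congr_fun hcomp p
  have hconst : q = Polynomial.C (eval u p) := by
    refine Polynomial.eq_of_infinite_eval_eq _ _ ?_
    refine (Set.infinite_range_of_injective (Nat.cast_injective (R := K))).mono ?_
    rintro _ ⟨n, rfl⟩
    simp [hq, h]
  rw [← hq, hconst, Polynomial.eval_C]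

theorem eval_sub2 (a b p : MvPolynomial (Fin 2) ℚ) (v : Fin 2 → ℚ) :
    eval v (sub2 a b p) = eval ![eval v a, eval v b] p := by
  have hcomp : (aeval v).comp (aeval ![a, b]) =
      (aeval ![eval v a, eval v b] : MvPolynomial (Fin 2) ℚ →ₐ[ℚ] ℚ) := by
    ext i
    fin_cases i <;> simp [aeval_eq_eval]
  simpa [sub2, aeval_eq_eval] using DFunLike.congr_fun hcomp p

/-- A polynomial whose restriction to a line is invariant up to sign under translation by `d`
is constant on that line. -/
theorem eval_add_smul_eq_of_eval_add {K σ : Type*} [Field K] [CharZero K]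
    (p : MvPolynomial σ K) (w : ℕ) (u d : σ → K)
    (h : ∀ s : K, eval (u + s • d) p = (-1) ^ w * eval (u + (s + 1) • d) p) (t : K) :
    eval (u + t • d) p = eval u p := by
  have hsq : ((-1 : K) ^ w) * (-1) ^ w = 1 := by rw [← mul_pow]; simp
  have hper : ∀ s : K, eval (u + (s + 2) • d) p = eval (u + s • d) p := by
    intro s
    rw [h s, h (s + 1), ← mul_assoc, hsq, one_mul, add_assoc, one_add_one_eq_two]
  have key := eval_add_smul_eq_of_forall_nat p u ((2 : K) • d) (fun n => by
    induction n with
    | zero => simp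
    | succ n ih =>
      rw [← ih, smul_smul, smul_smul, Nat.cast_succ, add_mul, one_mul, hper]) (t / 2)
  rwa [smul_smul, div_mul_cancel₀ _ two_ne_zero] at key

theorem stmt18 (w : ℕ) (hw : 1 ≤ w)
    (p : MvPolynomial (Fin 2) ℚ) (hhom : p.IsHomogeneous w)
    (h1 : p = ((-1 : ℚ) ^ w) • sub2 (X 0 + X 1) (X 1) p)
    (h2 : p = ((-1 : ℚ) ^ w) • sub2 (X 0) (X 0 + X 1) p) :
    p = 0 := by
  have e1 : ∀ x y : ℚ, eval ![x, y] p = (-1) ^ w * eval ![x + y, y] p := by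
    intro x y
    conv_lhs => rw [h1]
    simp [smul_eval, eval_sub2]
  have e2 : ∀ x y : ℚ, eval ![x, y] p = (-1) ^ w * eval ![x, x + y] p := by
    intro x y
    conv_lhs => rw [h2]
    simp [smul_eval, eval_sub2]
  have c1 : ∀ x y : ℚ, y ≠ 0 → eval ![x, y] p = eval ![0, y] p := by
    intro x y hy
    have key := eval_add_smul_eq_of_eval_add p w ![0, y] ![y, 0] (fun s => by
      simpa [add_mul] using e1 (s * y) y) (x / y)
    simpa [hy] using key
  have c2 : ∀ x y : ℚ, x ≠ 0 → eval ![x, y] p = eval ![x, 0] p := by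
    intro x y hx
    have key := eval_add_smul_eq_of_eval_add p w ![x, 0] ![0, x] (fun s => by
      simpa [add_mul, add_comm] using e2 x (s * x)) (y / x)
    simpa [hx] using key
  have c3 : ∀ x y : ℚ, y ≠ 0 → eval ![x, y] p = eval ![1, 0] p := fun x y hy => by
    rw [c1 x y hy, ← c1 1 y hy, c2 1 y one_ne_zero]
  have hscale : eval ![2, 2] p = 2 ^ w * eval ![1, 1] p := by
    simpa using hhom.eval_smul_eq 2 ![1, 1]
  have hzero : eval ![1, 0] p = 0 := by
    rw [c3 2 2 two_ne_zero, c3 1 1 one_ne_zero] at hscale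
    have h2w : (1 : ℚ) < 2 ^ w := one_lt_pow₀ one_lt_two (by omega)
    have : (2 ^ w - 1) * eval ![1, 0] p = 0 := by linarith
    exact (mul_eq_zero.mp this).resolve_left (by linarith)
  have hmul : X 1 * p = 0 := by
    refine MvPolynomial.funext fun v => ?_
    have hv : v = ![v 0, v 1] := by ext i; fin_cases i <;> rfl
    by_cases hy : v 1 = 0
    · simp [hy]
    · rw [map_mul, hv, c3 _ _ hy, hzero]; simp
  exact (mul_eq_zero.mp hmul).resolve_left (X_ne_zero 1)
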